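/- For each j ∈ {1,2} and each real A > 0 there exists a constant C depending only on j and A such that for every integer k ≥ 2 and every complex number s with Re s = A, one has |Λ_{k,j}(1/2 + s) / Λ_{k,j}(1/2)| ≤ C k^{jA}. -/

import Mathlib

noncomputable section

/-- e(x) = exp(2πi x) -/
def ee (x : ℝ) : ℂ := Complex.exp (2 * Real.pi * Complex.I * x)

/-- Bessel function of integer order: J_ℓ(x) = ∫_{-1/2}^{1/2} e(ℓt) e^{-ix sin(2πt)} dt -/
def besselJ (ℓ : ℕ) (x : ℝ) : ℂ :=
  ∫ t in (-(1:ℝ)/2)..(1/2), ee (ℓ * t) * Complex.exp (-Complex.I * x * Real.sin (2 * Real.pi * t))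

/-- Kloosterman sum S(n,m;c) -/
def kloos (n m : ℤ) (c : ℕ) : ℂ :=
  ∑ b ∈ Finset.range c, if Nat.Coprime b c then
    ee (((((n : ZMod c) * (b : ZMod c) + (m : ZMod c) * (b : ZMod c)⁻¹).val : ℕ) : ℝ) / c)
  else 0

/-- Λ_{k,j}(s) -/
def Lam (j : ℕ) (k : ℝ) (s : ℂ) : ℂ :=
  if j = 1 then (2 * Real.pi : ℂ) ^ (-s) * Complex.Gamma (s + (k : ℂ) - 1/2)
  else 8 * (2 * Real.pi : ℂ) ^ (-3*s - 3*(k:ℂ) + 3/2) * Complex.Gamma (s + 2*(k:ℂ) - 3/2) *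
    Complex.Gamma (s + (k:ℂ) - 1/2) * Complex.Gamma (s + 1/2)

/-- V_{k,j}(ξ), contour integral on Re s = 1 -/
def V (j : ℕ) (k : ℝ) (ξ : ℝ) : ℂ :=
  (1 / (2 * Real.pi * Complex.I)) * ∫ t : ℝ,
    (Lam j k (1/2 + (1 + (t:ℂ) * Complex.I)) / Lam j k (1/2)) *
      (ξ : ℂ) ^ (-(1 + (t:ℂ) * Complex.I)) / (1 + (t:ℂ) * Complex.I) * Complex.I

/-- Fourier transform ĥ(t) = ∫ h(v) e(−vt) dv -/
def fhat (h : ℝ → ℂ) (t : ℝ) : ℂ := ∫ v : ℝ, h v * ee (-(v * t))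

end

theorem norm_Gamma_le_aux {s : ℂ} (hs : 0 < s.re) : ‖Complex.Gamma s‖ ≤ Real.Gamma s.re := by
  rw [Complex.Gamma_eq_integral hs, Complex.GammaIntegral, Real.Gamma_eq_integral hs]
  refine (MeasureTheory.norm_integral_le_integral_norm _).trans (le_of_eq ?_)
  refine MeasureTheory.setIntegral_congr_fun measurableSet_Ioi ?_
  intro x hx
  have hx' : 0 < x := hx
  simp only []
  rw [norm_mul, Complex.norm_of_nonneg (Real.exp_pos _).le,
    Complex.norm_cpow_eq_rpow_re_of_pos hx']
  simp

theorem Gamma_add_nat_le_aux (N : ℝ) (x : ℝ) (hx : 1 ≤ x) (n : ℕ) (hn : (n : ℝ) ≤ N) :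
    Real.Gamma (x + n) ≤ (N * x) ^ n * Real.Gamma x := by
  induction n with
  | zero => simp
  | succ n ih =>
    push_cast at hn ⊢
    have h1 := ih (by linarith)
    have hn0 : (0 : ℝ) ≤ n := Nat.cast_nonneg n
    have hxn : 0 < x + n := by linarith
    rw [← add_assoc, Real.Gamma_add_one hxn.ne', pow_succ]
    have h2 : x + n ≤ N * x := by nlinarith
    calc (x + n) * Real.Gamma (x + n) ≤ (N * x) * ((N * x) ^ n * Real.Gamma x) :=
          mul_le_mul h2 h1 (Real.Gamma_pos_of_pos hxn).le (by nlinarith)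
      _ = _ := by ring

theorem Gamma_add_le_aux (A : ℝ) (hA : 0 < A) (x : ℝ) (hx : 1 ≤ x) :
    Real.Gamma (A + x) ≤ ((⌊A⌋₊ + 1 : ℕ) : ℝ) ^ A * x ^ A * Real.Gamma x := by
  set n : ℕ := ⌊A⌋₊ + 1 with hn
  have hAn : A < n := by rw [hn]; push_cast; exact Nat.lt_floor_add_one A
  have hn0 : (0 : ℝ) < n := hA.trans hAn
  have hx0 : 0 < x := by linarith
  have hG := Real.Gamma_pos_of_pos hx0
  have hb : 0 < A / n := by positivity
  have ha : 0 < 1 - A / n := by rw [sub_pos, div_lt_one hn0]; exact hAn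
  have h := Real.Gamma_mul_add_mul_le_rpow_Gamma_mul_rpow_Gamma hx0
    (show 0 < x + n by linarith) ha hb (by ring)
  have e : (1 - A / n) * x + A / n * (x + n) = A + x := by field_simp; ring
  rw [e] at h
  refine h.trans ?_
  have h2 : Real.Gamma (x + n) ^ (A / n) ≤ ((n * x) ^ n * Real.Gamma x) ^ (A / n) :=
    Real.rpow_le_rpow (Real.Gamma_pos_of_pos (by linarith)).le
      (Gamma_add_nat_le_aux n x hx n le_rfl) hb.le
  refine (mul_le_mul_of_nonneg_left h2 (by positivity)).trans (le_of_eq ?_)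
  rw [Real.mul_rpow (by positivity) hG.le, ← Real.rpow_natCast, ← Real.rpow_mul (by positivity),
    mul_div_cancel₀ _ hn0.ne', Real.mul_rpow hn0.le hx0.le, mul_left_comm, ← Real.rpow_add hG]
  simp

theorem Gamma_ratio_aux (A : ℝ) (hA : 0 < A) : ∃ C : ℝ, 0 ≤ C ∧ ∀ x : ℝ, 1 ≤ x → ∀ s : ℂ,
    s.re = A → ‖Complex.Gamma (s + x) / Complex.Gamma x‖ ≤ C * x ^ A := by
  refine ⟨((⌊A⌋₊ + 1 : ℕ) : ℝ) ^ A, by positivity, ?_⟩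
  intro x hx s hs
  have hG := Real.Gamma_pos_of_pos (show 0 < x by linarith)
  rw [norm_div, Complex.Gamma_ofReal, Complex.norm_of_nonneg hG.le, div_le_iff₀ hG]
  have h := norm_Gamma_le_aux (s := s + x) (by simp; linarith)
  refine h.trans ?_
  simp only [Complex.add_re, Complex.ofReal_re, hs]
  exact Gamma_add_le_aux A hA x hx

theorem two_pi_ratio_aux (a b : ℂ) (h : a.re ≤ b.re) :
    ‖(2 * Real.pi : ℂ) ^ a / (2 * Real.pi : ℂ) ^ b‖ ≤ 1 := by
  have hp : (0 : ℝ) < 2 * Real.pi := by positivity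
  have e : (2 * Real.pi : ℂ) = ((2 * Real.pi : ℝ) : ℂ) := by push_cast; rfl
  rw [norm_div, e, Complex.norm_cpow_eq_rpow_re_of_pos hp, Complex.norm_cpow_eq_rpow_re_of_pos hp]
  rw [div_le_one (by positivity)]
  exact Real.rpow_le_rpow_of_exponent_le (by linarith [Real.pi_gt_three]) h

theorem stmt10 (j : ℕ) (hj : j = 1 ∨ j = 2) (A : ℝ) (hA : 0 < A) :
    ∃ C : ℝ, ∀ k : ℕ, 2 ≤ k → ∀ s : ℂ, s.re = A →
      ‖Lam j (k : ℝ) (1/2 + s) / Lam j (k : ℝ) (1/2)‖ ≤ C * (k : ℝ) ^ ((j : ℝ) * A) := by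
  
  obtain ⟨C, hC, h⟩ := Gamma_ratio_aux A hA
  rcases hj with rfl | rfl
  · refine ⟨C, fun k hk s hs => ?_⟩
    have hk1 : (1 : ℝ) ≤ k := by exact_mod_cast (by omega : 1 ≤ k)
    have h1 := h k hk1 s hs
    have h2 := two_pi_ratio_aux (-(1 / 2 + s)) (-(1 / 2)) (by simp [hs]; linarith)
    simp only [Lam, if_true]
    rw [mul_div_mul_comm, norm_mul]
    have e1 : (1 / 2 + s + ((k : ℝ) : ℂ) - 1 / 2) = s + ((k : ℝ) : ℂ) := by ring
    have e2 : (1 / 2 + ((k : ℝ) : ℂ) - 1 / 2) = ((k : ℝ) : ℂ) := by ring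
    rw [e1, e2]
    simpa using mul_le_mul h2 h1 (norm_nonneg _) zero_le_one
  · refine ⟨C * 2 ^ A * C * C, fun k hk s hs => ?_⟩
    have hk1 : (1 : ℝ) ≤ k := by exact_mod_cast (by omega : 1 ≤ k)
    have hk0 : (0 : ℝ) < k := by linarith
    have h1 := h k hk1 s hs
    have h3 := h (2 * k - 1) (by linarith) s hs
    have h4 := h 1 le_rfl s hs
    have h2 := two_pi_ratio_aux (-3 * (1 / 2 + s) - 3 * ((k : ℝ) : ℂ) + 3 / 2)
      (-3 * (1 / 2) - 3 * ((k : ℝ) : ℂ) + 3 / 2) (by simp [hs]; linarith)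
    have h5 : (2 * (k : ℝ) - 1) ^ A ≤ 2 ^ A * (k : ℝ) ^ A := by
      rw [← Real.mul_rpow (by norm_num) hk0.le]
      exact Real.rpow_le_rpow (by linarith) (by linarith) hA.le
    have h3' := h3.trans (mul_le_mul_of_nonneg_left h5 hC)
    have e1 : (1 / 2 + s + ((k : ℝ) : ℂ) - 1 / 2) = s + ((k : ℝ) : ℂ) := by ring
    have e2 : (1 / 2 + ((k : ℝ) : ℂ) - 1 / 2) = ((k : ℝ) : ℂ) := by ring
    have e3 : (1 / 2 + s + 2 * ((k : ℝ) : ℂ) - 3 / 2) = s + ((2 * k - 1 : ℝ) : ℂ) := by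
      push_cast; ring
    have e4 : (1 / 2 + 2 * ((k : ℝ) : ℂ) - 3 / 2) = ((2 * k - 1 : ℝ) : ℂ) := by
      push_cast; ring
    have e5 : (1 / 2 + s + 1 / 2) = s + ((1 : ℝ) : ℂ) := by push_cast; ring
    have e6 : (1 / 2 + 1 / 2 : ℂ) = ((1 : ℝ) : ℂ) := by push_cast; ring
    have e7 : (k : ℝ) ^ (((2 : ℕ) : ℝ) * A) = (k : ℝ) ^ A * (k : ℝ) ^ A := by
      rw [← Real.rpow_add hk0]; congr 1; push_cast; ring
    simp only [Lam, if_neg (show ¬ ((2 : ℕ) = 1) by norm_num)]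
    rw [e1, e2, e3, e4, e5, e6, e7, mul_div_mul_comm, mul_div_mul_comm, mul_div_mul_comm,
      mul_div_mul_comm, div_self (by norm_num : (8 : ℂ) ≠ 0), one_mul, norm_mul, norm_mul, norm_mul]
    rw [Real.one_rpow, mul_one] at h4
    have hkA : (0 : ℝ) ≤ (k : ℝ) ^ A := by positivity
    have h2A : (0 : ℝ) ≤ (2 : ℝ) ^ A := by positivity
    calc _ ≤ 1 * (C * (2 ^ A * (k : ℝ) ^ A)) * (C * (k : ℝ) ^ A) * C := by gcongr
      _ = _ := by ring
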